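/- arXiv:1909.07446 — 3 statements merged into one kernel-verified Lean document; each statement's English description precedes it below -/
import Mathlib

section
/- Let G be a finite simple connected undirected graph whose set of leaves has exactly three elements. Then G contains a sapling, or there exists a set X ⊆ V(G) such that G admits an X-net all of whose arcs are simple. -/
attribute [local instance] Classical.propDecidable

namespace ThreeInATree

variable {V : Type*}

/-- A leaf of a simple graph: a vertex with exactly one neighbor. -/
def IsLeaf (G : SimpleGraph V) (v : V) : Prop := ∃! w, G.Adj v w

/-- A vertex set inducing a path graph (a tree of maximum degree at most two). -/
def IsPathSet (G : SimpleGraph V) (P : Set V) : Prop :=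
  (G.induce P).IsTree ∧
    ∀ v ∈ P, ∀ a ∈ P, ∀ b ∈ P, ∀ c ∈ P,
      G.Adj v a → G.Adj v b → G.Adj v c → a = b ∨ a = c ∨ b = c

/-- `v` is an end-vertex of the path with vertex set `P`: it has at most one
neighbor inside `P`. -/
def IsEndOf (G : SimpleGraph V) (P : Set V) (v : V) : Prop :=
  v ∈ P ∧ ∀ a ∈ P, ∀ b ∈ P, G.Adj v a → G.Adj v b → a = b

/-- A `UW`-path: either a single vertex in `U ∩ W`, or an (induced) path with one
end-vertex in `U` and the other in `W`. -/
def IsUWPath (G : SimpleGraph V) (U W P : Set V) : Prop :=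
  (∃ x, x ∈ U ∧ x ∈ W ∧ P = {x}) ∨
  (IsPathSet G P ∧ ∃ u w, u ≠ w ∧ u ∈ U ∧ w ∈ W ∧ IsEndOf G P u ∧ IsEndOf G P w)

/-- A `UW`-rung of `G[A]`: a vertex-minimal induced `UW`-path inside `A`. -/
def IsRungIn (G : SimpleGraph V) (A U W P : Set V) : Prop :=
  P ⊆ A ∧ IsUWPath G U W P ∧ ∀ Q, Q ⊆ A → IsUWPath G U W Q → P.ncard ≤ Q.ncard

/-- A sapling: an induced tree containing all (three) leaves of `G`. -/
def IsSapling (G : SimpleGraph V) (T : Set V) : Prop :=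
  (G.induce T).IsTree ∧ ∀ v, IsLeaf G v → v ∈ T

def SaplingFree (G : SimpleGraph V) : Prop := ¬ ∃ T, IsSapling G T

/-- A multigraph whose nodes and arcs are vertex sets; each arc `E` has the two
end-nodes `fst E` and `snd E`. -/
structure Net (V : Type*) where
  nodes : Set (Set V)
  arcs : Set (Set V)
  fst : Set V → Set V
  snd : Set V → Set V

namespace Net

/-- The node `N` is an end-node of the arc `E`. -/
def EndsAt (H : Net V) (E N : Set V) : Prop := H.fst E = N ∨ H.snd E = N

/-- Two nodes joined by some arc. -/
def AdjNodes (H : Net V) (U W : Set V) : Prop :=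
  U ≠ W ∧ ∃ E ∈ H.arcs, (H.fst E = U ∧ H.snd E = W) ∨ (H.fst E = W ∧ H.snd E = U)

/-- A leaf node of the net: a node incident to exactly one arc. -/
def IsLeafNode (H : Net V) (N : Set V) : Prop :=
  N ∈ H.nodes ∧ ∃! E, E ∈ H.arcs ∧ H.EndsAt E N

/-- The underlying simple graph of the net on node sets. -/
def graph (H : Net V) : SimpleGraph (Set V) :=
  SimpleGraph.fromRel (fun U W => U ∈ H.nodes ∧ W ∈ H.nodes ∧ H.AdjNodes U W)

/-- `∇(ℍ)`: the net together with an edge between each pair of its leaf nodes. -/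
def nabla (H : Net V) : SimpleGraph (Set V) :=
  SimpleGraph.fromRel (fun U W =>
    (U ∈ H.nodes ∧ W ∈ H.nodes ∧ H.AdjNodes U W) ∨ (H.IsLeafNode U ∧ H.IsLeafNode W))

end Net

/-- A biconnected graph: connected, and still connected after deleting any vertex. -/
def IsBiconnected {α : Type*} (H : SimpleGraph α) : Prop :=
  H.Connected ∧ ∀ v : α, (H.induce {w | w ≠ v}).Connected

/-- Conditions (N1)–(N6): `H` is an `X`-net of `G`. -/
structure IsNet (G : SimpleGraph V) (X : Set V) (H : Net V) : Prop where
  nodes_sub : ∀ N ∈ H.nodes, N ⊆ X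
  fst_mem : ∀ E ∈ H.arcs, H.fst E ∈ H.nodes
  snd_mem : ∀ E ∈ H.arcs, H.snd E ∈ H.nodes
  ends_ne : ∀ E ∈ H.arcs, H.fst E ≠ H.snd E
  conn : (H.graph.induce H.nodes).Connected
  bicon : IsBiconnected (H.nabla.induce H.nodes)
  arcs_nonempty : H.arcs.Nonempty
  arcs_disjoint : ∀ E ∈ H.arcs, ∀ F ∈ H.arcs, E ≠ F → E ∩ F = ∅
  arcs_cover : ⋃₀ H.arcs = X
  leaf_count : {N | H.IsLeafNode N}.ncard = 3
  leaf_single : ∀ N, H.IsLeafNode N → ∃ v, IsLeaf G v ∧ N = {v}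
  rungs : ∀ E ∈ H.arcs, ∀ x ∈ E, ∃ P, x ∈ P ∧ IsRungIn G E (H.fst E) (H.snd E) P
  meets_iff : ∀ E ∈ H.arcs, ∀ N ∈ H.nodes, ((E ∩ N).Nonempty ↔ H.EndsAt E N)
  adj_iff : ∀ E ∈ H.arcs, ∀ F ∈ H.arcs, E ≠ F → ∀ u ∈ E, ∀ v ∈ F,
      (G.Adj u v ↔ ∃ N ∈ H.nodes, H.EndsAt E N ∧ H.EndsAt F N ∧ u ∈ N ∧ v ∈ N)

/-- An arc `E` is simple if `G[E]` is itself a rung between its end-nodes. -/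
def SimpleArc (G : SimpleGraph V) (H : Net V) (E : Set V) : Prop :=
  IsRungIn G E (H.fst E) (H.snd E) E

/-- An `(S,V1,V2)`-sprout inside `G[A]`, of one of the three Types S1, S2, S3. -/
def IsSproutIn (G : SimpleGraph V) (A S V1 V2 T : Set V) : Prop :=
  T ⊆ A ∧
  (((G.induce T).IsTree ∧ (T ∩ S).ncard = 1 ∧ (T ∩ V1).ncard = 1 ∧ (T ∩ V2).ncard = 1) ∨
   (∃ P Q, T = P ∪ Q ∧ P ∩ Q = ∅ ∧
      IsRungIn G A S V1 P ∧ P ∩ V2 = ∅ ∧ IsRungIn G A S V2 Q ∧ Q ∩ V1 = ∅) ∨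
   (∃ P Q, T = P ∪ Q ∧ P ∩ Q = ∅ ∧
      IsRungIn G A V1 V2 P ∧ P ∩ S = ∅ ∧ IsRungIn G A S (V1 ∪ V2) Q))

/-- An arc `E` is flexible if `G[E]` contains an `(S, fst E, snd E)`-sprout for
every nonempty `S ⊆ E`. -/
def FlexibleArc (G : SimpleGraph V) (H : Net V) (E : Set V) : Prop :=
  ∀ S : Set V, S.Nonempty → S ⊆ E → ∃ T, IsSproutIn G E S (H.fst E) (H.snd E) T

/-- An `X`-web: an `X`-net all of whose arcs are simple or flexible. -/
def IsWeb (G : SimpleGraph V) (X : Set V) (H : Net V) : Prop :=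
  IsNet G X H ∧ ∀ E ∈ H.arcs, SimpleArc G H E ∨ FlexibleArc G H E

/-- `{U, W}` is a cutset of `∇(ℍ)` (restricted to the nodes). -/
def Net.CutPairNabla (H : Net V) (U W : Set V) : Prop :=
  U ∈ H.nodes ∧ W ∈ H.nodes ∧ U ≠ W ∧
    Nat.card ((H.nabla.induce (H.nodes \ {U, W})).ConnectedComponent) >
      Nat.card ((H.nabla.induce H.nodes).ConnectedComponent)

/-- `U` and `W` do not form a cutset of the subgraph `Gs`. -/
def NoCutPair {α : Type*} {Γ : SimpleGraph α} (Gs : Γ.Subgraph) (U W : α) : Prop :=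
  Nat.card ((Gs.deleteVerts {U, W}).coe.ConnectedComponent) ≤
    Nat.card (Gs.coe.ConnectedComponent)

/-- `A` is the arc set of a split component of `ℍ` with split pair `{U, W}`:
either a single arc with end-nodes `U` and `W`, or the arcs of a maximal
subgraph `Gs` of `∇(ℍ)` containing the cutset `{U, W}` of `∇(ℍ)` in which `U`
and `W` are nonadjacent and do not form a cutset. -/
def IsSplitCompArcs (H : Net V) (U W : Set V) (A : Set (Set V)) : Prop :=
  (∃ E ∈ H.arcs, A = {E} ∧
     ((H.fst E = U ∧ H.snd E = W) ∨ (H.fst E = W ∧ H.snd E = U))) ∨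
  (H.CutPairNabla U W ∧
   ∃ Gs : (H.nabla).Subgraph,
     U ∈ Gs.verts ∧ W ∈ Gs.verts ∧ ¬ Gs.Adj U W ∧ NoCutPair Gs U W ∧
     (∀ Gs' : (H.nabla).Subgraph, Gs ≤ Gs' → U ∈ Gs'.verts → W ∈ Gs'.verts →
        ¬ Gs'.Adj U W → NoCutPair Gs' U W → Gs' = Gs) ∧
     A = {E | E ∈ H.arcs ∧ Gs.Adj (H.fst E) (H.snd E)})

/-- `C` is a `UW`-chunk of `ℍ`: the union of the arcs of one or more split
components sharing the split pair `{U, W}`. -/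
def IsChunk (H : Net V) (U W : Set V) (C : Set V) : Prop :=
  ∃ 𝒜 : Set (Set (Set V)), 𝒜.Nonempty ∧
    (∀ A ∈ 𝒜, IsSplitCompArcs H U W A) ∧ C = ⋃₀ (⋃₀ 𝒜)

def IsChunkOf (H : Net V) (C : Set V) : Prop := ∃ U W, IsChunk H U W C

/-- A maximal chunk: a chunk not properly contained in any other chunk. -/
def IsMaxChunk (H : Net V) (C : Set V) : Prop :=
  IsChunkOf H C ∧ ∀ C', IsChunkOf H C' → C ⊆ C' → C' = C

/-- The operation `merge(C)` for a `V1V2`-chunk `C`: replace all arcs meeting `C`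
by a single arc `C` with end-nodes `V1, V2`, and delete the nodes all of whose
incident arcs were deleted. -/
noncomputable def Net.merge (H : Net V) (V1 V2 C : Set V) : Net V where
  nodes := {N | N ∈ H.nodes ∧
    ((∃ E ∈ H.arcs, E ∩ C = ∅ ∧ (H.fst E = N ∨ H.snd E = N)) ∨ N = V1 ∨ N = V2)}
  arcs := {E | E ∈ H.arcs ∧ E ∩ C = ∅} ∪ {C}
  fst := fun E => if E = C then V1 else H.fst E
  snd := fun E => if E = C then V2 else H.snd E

/-- A split pair for the chunk `C` (chosen arbitrarily). -/
noncomputable def chunkEnds (H : Net V) (C : Set V) : Set V × Set V :=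
  if h : ∃ p : Set V × Set V, IsChunk H p.1 p.2 C then h.choose else (∅, ∅)

/-- The aiding net `ℍ†` of `ℍ`, obtained by merging every maximal chunk: its arcs
are the maximal chunks of `ℍ` and its nodes are the maximal split nodes of `ℍ`. -/
noncomputable def Net.aiding (H : Net V) : Net V where
  nodes := {N | ∃ C, IsMaxChunk H C ∧ ((chunkEnds H C).1 = N ∨ (chunkEnds H C).2 = N)}
  arcs := {C | IsMaxChunk H C}
  fst := fun C => (chunkEnds H C).1
  snd := fun C => (chunkEnds H C).2

/-- A set `S ⊆ X` is `ℍ`-tamed: every two of its vertices lie in a common arc or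
in a common node of `ℍ`. -/
def Tamed (H : Net V) (S : Set V) : Prop :=
  ∀ u ∈ S, ∀ v ∈ S,
    (∃ E ∈ H.arcs, u ∈ E ∧ v ∈ E) ∨ (∃ N ∈ H.nodes, u ∈ N ∧ v ∈ N)

/-- `N_G(Y, X)`: the neighbors of `Y` inside `X`. -/
def NX (G : SimpleGraph V) (X Y : Set V) : Set V := {x ∈ X | ∃ y ∈ Y, G.Adj y x}

/-- A set `Y ⊆ V(G) ∖ X` is `ℍ`-tamed if `N(Y) ∩ X` is `ℍ`-tamed. -/
def TamedOut (G : SimpleGraph V) (X : Set V) (H : Net V) (Y : Set V) : Prop :=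
  Tamed H (NX G X Y)

/-- `ℍ` is taming: every connected `Y ⊆ V(G) ∖ X` is `ℍ`-tamed. -/
def Taming (G : SimpleGraph V) (X : Set V) (H : Net V) : Prop :=
  ∀ Y : Set V, Y ⊆ Xᶜ → (G.induce Y).Connected → TamedOut G X H Y

/-- An `ℍ`-wild set: a minimally `ℍ`-untamed `Y ⊆ V(G) ∖ X` inducing a path. -/
def Wild (G : SimpleGraph V) (X : Set V) (H : Net V) (Y : Set V) : Prop :=
  Y ⊆ Xᶜ ∧ IsPathSet G Y ∧ ¬ TamedOut G X H Y ∧ ∀ Z, Z ⊂ Y → TamedOut G X H Z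

/-- An `ℍ`-solid subset of `X`: a node of `ℍ`, or a subset `S` of an arc `E`
such that `G[E]` contains no `(S, fst E, snd E)`-sprout. -/
def SolidSet (G : SimpleGraph V) (H : Net V) (S : Set V) : Prop :=
  S ∈ H.nodes ∨
    ∃ E ∈ H.arcs, S ⊆ E ∧ ¬ ∃ T, IsSproutIn G E S (H.fst E) (H.snd E) T

/-- An `ℍ`-solid set `Y ⊆ V(G) ∖ X` inducing a path: `N(Y) ∩ X` is the union of
two `ℍ`-solid sets and no internal vertex of the path has a neighbor in `X`. -/
def SolidOut (G : SimpleGraph V) (X : Set V) (H : Net V) (Y : Set V) : Prop :=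
  (∃ S1 S2, SolidSet G H S1 ∧ SolidSet G H S2 ∧ NX G X Y = S1 ∪ S2) ∧
    ∀ y ∈ Y, ¬ IsEndOf G Y y → NX G X {y} = ∅

/-- `C` is a pod of `Y` in `ℍ`: a `V1V2`-chunk satisfying Conditions P1 and P2. -/
def IsPodOf (G : SimpleGraph V) (X : Set V) (H : Net V) (Y C : Set V) : Prop :=
  ∃ V1 V2, IsChunk H V1 V2 C ∧
    NX G X Y ⊆ V1 ∪ C ∪ V2 ∧
    (∃ y, IsEndOf G Y y ∧ ({v ∈ V1 | G.Adj y v} ⊆ C ∨ V1 ⊆ C ∪ {v | G.Adj y v})) ∧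
    (∃ y, IsEndOf G Y y ∧ ({v ∈ V2 | G.Adj y v} ⊆ C ∨ V2 ⊆ C ∪ {v | G.Adj y v}))

def Podded (G : SimpleGraph V) (X : Set V) (H : Net V) (Y : Set V) : Prop :=
  ∃ C, IsPodOf G X H Y C

def Sticky (G : SimpleGraph V) (X : Set V) (H : Net V) (Y : Set V) : Prop :=
  SolidOut G X H Y ∨ Podded G X H Y

/-- A triad of `ℍ`: `Δ(V1,V2,V3)` for three nodes inducing a triangle in `ℍ`. -/
def IsTriad (H : Net V) (T : Set V) : Prop :=
  ∃ V1 V2 V3, V1 ∈ H.nodes ∧ V2 ∈ H.nodes ∧ V3 ∈ H.nodes ∧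
    H.AdjNodes V1 V2 ∧ H.AdjNodes V2 V3 ∧ H.AdjNodes V1 V3 ∧
    T = (V1 ∩ V2) ∪ (V2 ∩ V3) ∪ (V3 ∩ V1)

/-- A set `S ⊆ X` is `ℍ`-local: contained in a node, an arc, or a triad. -/
def LocalSet (H : Net V) (S : Set V) : Prop :=
  (∃ N ∈ H.nodes, S ⊆ N) ∨ (∃ E ∈ H.arcs, S ⊆ E) ∨ ∃ T, IsTriad H T ∧ S ⊆ T

/-- `ℍ` is local: every connected `Y ⊆ V(G) ∖ X` is `ℍ`-local. -/
def LocalNet (G : SimpleGraph V) (X : Set V) (H : Net V) : Prop :=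
  ∀ Y : Set V, Y ⊆ Xᶜ → (G.induce Y).Connected → LocalSet H (NX G X Y)

/-- `ℍ` has no parallel arcs. -/
def NoParallel (H : Net V) : Prop :=
  ∀ E ∈ H.arcs, ∀ F ∈ H.arcs, E ≠ F →
    ({H.fst E, H.snd E} : Set (Set V)) ≠ {H.fst F, H.snd F}

/-- `ℓ(Y, ℍ, G)`: the minimum number of `ℍ`-tamed subsets of `X` whose union is
`N_G(Y, X)`. -/
noncomputable def ell (G : SimpleGraph V) (X : Set V) (H : Net V) (Y : Set V) : ℕ :=
  sInf {k | ∃ F : Finset (Set V), F.card = k ∧ (∀ S ∈ F, S ⊆ X ∧ Tamed H S) ∧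
    ⋃₀ (↑F : Set (Set V)) = NX G X Y}



theorem reach_inv {α : Type*} {G : SimpleGraph α} {P : α → Prop}
    (h : ∀ x y, G.Adj x y → P x → P y) {a b : α} (hr : G.Reachable a b) (ha : P a) : P b := by
  obtain ⟨p⟩ := hr
  induction p with
  | nil => exact ha
  | cons hadj _ ih => exact ih (h _ _ hadj ha)

theorem tree_insert {G : SimpleGraph V} {T : Set V} (hT : (G.induce T).IsTree) {v w : V}
    (hv : v ∉ T) (hw : w ∈ T) (hvw : G.Adj v w) (hu : ∀ z ∈ T, G.Adj v z → z = w) :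
    (G.induce (insert v T)).IsTree := by
  have hvT : v ∈ insert v T := Set.mem_insert _ _
  have hwT : w ∈ insert v T := Set.mem_insert_of_mem _ hw
  refine ⟨?_, ?_⟩
  · have key : ∀ z : V, ∀ hz : z ∈ insert v T,
        (G.induce (insert v T)).Reachable ⟨w, hwT⟩ ⟨z, hz⟩ := by
      intro z hz
      rcases hz with rfl | hz
      · exact SimpleGraph.Adj.reachable (by simpa using hvw.symm)
      · have := hT.1.preconnected ⟨w, hw⟩ ⟨z, hz⟩
        exact this.map (SimpleGraph.induceHomOfLE G (Set.subset_insert v T)).toHom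
    have : Nonempty ↑(insert v T) := ⟨⟨v, hvT⟩⟩
    exact ⟨fun x y => (key x.1 x.2).symm.trans (key y.1 y.2)⟩
  · rw [SimpleGraph.isAcyclic_iff_forall_adj_isBridge]
    have hac := SimpleGraph.isAcyclic_iff_forall_adj_isBridge.1 hT.2
    rintro ⟨x, hx⟩ ⟨y, hy⟩ hxy
    rw [SimpleGraph.isBridge_iff]
    intro hr
    have hxy' : G.Adj x y := by simpa using hxy
    -- an edge at v cannot be bypassed
    have hpend : ∀ (hw' : w ∈ insert v T) (hv' : v ∈ insert v T),
        ¬ ((G.induce (insert v T)).deleteEdges {s(⟨v, hv'⟩, ⟨w, hw'⟩)}).Reachable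
          ⟨v, hv'⟩ ⟨w, hw'⟩ := by
      intro hw' hv' hr
      have := reach_inv (P := fun z => z.1 = v) ?_ hr rfl
      · simp only at this
        exact hv (this ▸ hw)
      · rintro ⟨p, hp⟩ ⟨q, hq⟩ hpq hpv
        simp only at hpv
        subst hpv
        rcases hq with rfl | hq
        · rfl
        · have h1 : G.Adj p q := by
            have := hpq
            simp at this
            exact this.1
          have := hu q hq h1
          subst this
          simp at hpq
    by_cases hxv : x = v
    · subst hxv
      have hyT : y ∈ T := by
        rcases hy with rfl | h
        · exact absurd hxy' (G.irrefl)
        · exact h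
      have := hu y hyT hxy'
      subst this
      exact hpend _ _ hr
    by_cases hyv : y = v
    · subst hyv
      have hxT : x ∈ T := by
        rcases hx with rfl | h
        · exact absurd hxy' (G.irrefl)
        · exact h
      have := hu x hxT hxy'.symm
      subst this
      rw [Sym2.eq_swap] at hr
      exact hpend _ _ hr.symm
    have hxT : x ∈ T := hx.resolve_left hxv
    have hyT : y ∈ T := hy.resolve_left hyv
    have hb := @hac ⟨x, hxT⟩ ⟨y, hyT⟩ (by simpa using hxy')
    rw [SimpleGraph.isBridge_iff] at hb
    apply hb
    have := reach_inv (P := fun z => ∀ u (hu' : u ∈ T), (u = z.1 ∨ (z.1 = v ∧ u = w)) →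
      ((G.induce T).deleteEdges {s(⟨x, hxT⟩, ⟨y, hyT⟩)}).Reachable ⟨x, hxT⟩ ⟨u, hu'⟩) ?_ hr ?_
    · exact this y hyT (Or.inl rfl)
    · rintro ⟨p, hp⟩ ⟨q, hq⟩ hpq ih u huT hcase
      have h1 : G.Adj p q := by
        have := hpq
        simp at this
        exact this.1
      simp only at ih hcase
      by_cases hpv : p = v
      · subst hpv
        have hqT : q ∈ T := by
          rcases hq with rfl | h
          · exact absurd h1 (G.irrefl)
          · exact h
        have h2 := hu q hqT h1
        subst h2
        have : u = q := by
          rcases hcase with h | h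
          · exact h
          · exact h.2
        exact ih u huT (Or.inr ⟨rfl, this⟩)
      · have hpT : p ∈ T := hp.resolve_left hpv
        rcases hcase with rfl | ⟨rfl, rfl⟩
        · refine (ih p hpT (Or.inl rfl)).trans (SimpleGraph.Adj.reachable ?_)
          simp at hpq ⊢
          exact hpq
        · have h2 := hu p hpT h1.symm
          exact ih u huT (Or.inl h2.symm)
    · intro u huT hcase
      rcases hcase with rfl | ⟨h, _⟩
      · exact SimpleGraph.Reachable.refl _
      · exact absurd h hxv

structure Arm (G : SimpleGraph V) (f : ℕ → V) (m : ℕ) : Prop where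
  inj : ∀ i ≤ m, ∀ j ≤ m, f i = f j → i = j
  adj : ∀ i ≤ m, ∀ j ≤ m, (G.Adj (f i) (f j) ↔ i + 1 = j ∨ j + 1 = i)

def img (f : ℕ → V) (m : ℕ) : Set V := {v | ∃ i ≤ m, f i = v}

theorem img_zero (f : ℕ → V) : img f 0 = {f 0} := by
  ext v; simp [img, eq_comm]

theorem img_succ (f : ℕ → V) (m : ℕ) : img f (m+1) = insert (f (m+1)) (img f m) := by
  ext v
  simp only [img, Set.mem_ofPred_eq, Set.mem_insert_iff]
  constructor
  · rintro ⟨i, hi, rfl⟩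
    rcases Nat.lt_or_ge m i with h | h
    · left; congr 1; omega
    · right; exact ⟨i, h, rfl⟩
  · rintro (rfl | ⟨i, hi, rfl⟩)
    · exact ⟨_, le_rfl, rfl⟩
    · exact ⟨i, by omega, rfl⟩

theorem Arm.mono {G : SimpleGraph V} {f : ℕ → V} {m k : ℕ} (h : Arm G f m) (hk : k ≤ m) :
    Arm G f k :=
  ⟨fun i hi j hj => h.inj i (by omega) j (by omega),
   fun i hi j hj => h.adj i (by omega) j (by omega)⟩

theorem Arm.shift {G : SimpleGraph V} {f : ℕ → V} {m : ℕ} (h : Arm G f m) (a k : ℕ)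
    (hk : a + k ≤ m) : Arm G (fun i => f (a + i)) k :=
  ⟨fun i hi j hj e => by have := h.inj (a+i) (by omega) (a+j) (by omega) e; omega,
   fun i hi j hj => by
    have := h.adj (a+i) (by omega) (a+j) (by omega)
    rw [this]; omega⟩

theorem Arm.rev {G : SimpleGraph V} {f : ℕ → V} {m : ℕ} (h : Arm G f m) (k : ℕ)
    (hk : k ≤ m) : Arm G (fun i => f (m - i)) k :=
  ⟨fun i hi j hj e => by have := h.inj (m-i) (by omega) (m-j) (by omega) e; omega,
   fun i hi j hj => by
    have := h.adj (m-i) (by omega) (m-j) (by omega)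
    rw [this]; omega⟩

theorem Arm.tree {G : SimpleGraph V} {f : ℕ → V} {m : ℕ} (h : Arm G f m) :
    (G.induce (img f m)).IsTree := by
  induction m with
  | zero =>
    rw [img_zero]
    exact SimpleGraph.IsTree.of_subsingleton
  | succ m ih =>
    rw [img_succ]
    refine tree_insert (ih (h.mono (by omega))) (w := f m) ?_ ⟨m, le_rfl, rfl⟩ ?_ ?_
    · rintro ⟨i, hi, e⟩
      have := h.inj i (by omega) (m+1) le_rfl e
      omega
    · rw [h.adj _ le_rfl _ (by omega)]; omega
    · rintro z ⟨i, hi, rfl⟩ hz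
      rw [h.adj _ le_rfl _ (by omega)] at hz
      congr 1; omega

theorem attach {G : SimpleGraph V} {f : ℕ → V} {m : ℕ} {T : Set V} (hT : (G.induce T).IsTree)
    (h : Arm G f m) (hd : ∀ i ≤ m, f i ∉ T) {w : V} (hw : w ∈ T) (hadj : G.Adj (f 0) w)
    (hu : ∀ z ∈ T, G.Adj (f 0) z → z = w)
    (hn : ∀ i ≤ m, 0 < i → ∀ z ∈ T, ¬ G.Adj (f i) z) :
    (G.induce (T ∪ img f m)).IsTree := by
  induction m with
  | zero =>
    rw [img_zero, Set.union_singleton]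
    exact tree_insert hT (hd 0 le_rfl) hw hadj hu
  | succ m ih =>
    rw [img_succ, Set.union_insert]
    refine tree_insert (ih (h.mono (by omega)) (fun i hi => hd i (by omega))
      (fun i hi => hn i (by omega))) (w := f m) ?_ (Or.inr ⟨m, le_rfl, rfl⟩) ?_ ?_
    · rintro (h1 | ⟨i, hi, e⟩)
      · exact hd _ le_rfl h1
      · have := h.inj i (by omega) (m+1) le_rfl e
        omega
    · rw [h.adj _ le_rfl _ (by omega)]; omega
    · rintro z (h1 | ⟨i, hi, rfl⟩) hz
      · exact absurd hz (hn _ le_rfl (by omega) z h1)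
      · rw [h.adj _ le_rfl _ (by omega)] at hz
        congr 1; omega

theorem arm_of_dist {G : SimpleGraph V} (hG : G.Connected) (u v : V) :
    ∃ f : ℕ → V, f 0 = u ∧ f (G.dist u v) = v ∧ Arm G f (G.dist u v) ∧
      ∀ i ≤ G.dist u v, G.dist u (f i) = i := by
  obtain ⟨p, hp⟩ := hG.exists_walk_length_eq_dist u v
  have hd : ∀ i ≤ G.dist u v, G.dist u (p.getVert i) = i := by
    intro i hi
    have h1 : G.dist u (p.getVert i) ≤ i := by
      have := SimpleGraph.dist_le (p.take i)
      rw [SimpleGraph.Walk.take_length] at this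
      omega
    have h2 : G.dist (p.getVert i) v ≤ G.dist u v - i := by
      have := SimpleGraph.dist_le (p.drop i)
      rw [SimpleGraph.Walk.drop_length] at this
      omega
    have h3 := hG.dist_triangle (u := u) (v := p.getVert i) (w := v)
    omega
  have hs : ∀ i, i + 1 ≤ G.dist u v → G.Adj (p.getVert i) (p.getVert (i+1)) := fun i hi =>
    p.adj_getVert_succ (by omega)
  refine ⟨p.getVert, by simp, by rw [← hp]; simp, ⟨?_, ?_⟩, hd⟩
  · intro i hi j hj e
    rw [← hd i hi, ← hd j hj, e]
  · intro i hi j hj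
    constructor
    · intro hadj
      have h1 := hadj.diff_dist_adj (u := u)
      have hne : i ≠ j := by rintro rfl; exact G.irrefl hadj
      rw [hd i hi, hd j hj] at h1
      omega
    · rintro (rfl | rfl)
      · exact hs _ hj
      · exact (hs _ hi).symm

theorem arm_rung {G : SimpleGraph V} {f : ℕ → V} {m : ℕ} (h : Arm G f m) (hm : 0 < m)
    {U C : Set V} (hU : U = {f 0}) (hC : ∀ i ≤ m, f i ∈ C ↔ i = m) :
    IsRungIn G (img f m) U C (img f m) := by
  subst hU
  have hfin : (img f m).Finite := (Set.finite_Iic m).image f |>.subset (by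
    rintro v ⟨i, hi, rfl⟩; exact ⟨i, hi, rfl⟩)
  refine ⟨subset_rfl, Or.inr ⟨⟨h.tree, ?_⟩, f 0, f m, ?_, rfl, (hC m le_rfl).2 rfl, ?_, ?_⟩, ?_⟩
  · rintro _ ⟨i, hi, rfl⟩ _ ⟨a, ha, rfl⟩ _ ⟨b, hb, rfl⟩ _ ⟨c, hc, rfl⟩ h1 h2 h3
    rw [h.adj _ hi _ (by assumption)] at h1 h2 h3
    have : a = b ∨ a = c ∨ b = c := by omega
    rcases this with rfl | rfl | rfl <;> simp
  · intro e
    have := h.inj _ (by omega) _ le_rfl e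
    omega
  · refine ⟨⟨0, by omega, rfl⟩, ?_⟩
    rintro _ ⟨a, ha, rfl⟩ _ ⟨b, hb, rfl⟩ h1 h2
    rw [h.adj _ (by omega) _ (by assumption)] at h1 h2
    congr 1; omega
  · refine ⟨⟨m, by omega, rfl⟩, ?_⟩
    rintro _ ⟨a, ha, rfl⟩ _ ⟨b, hb, rfl⟩ h1 h2
    rw [h.adj _ (by omega) _ (by assumption)] at h1 h2
    congr 1; omega
  · intro Q hQ hUW
    rcases hUW with ⟨x, hx1, hx2, rfl⟩ | ⟨⟨hT, -⟩, u, w, hne, hu, hw, hu', hw'⟩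
    · rw [Set.mem_singleton_iff] at hx1
      subst hx1
      have := (hC 0 (by omega)).1 hx2
      omega
    · rw [Set.mem_singleton_iff] at hu
      subst hu
      obtain ⟨k, hk, rfl⟩ := hQ hw'.1
      obtain rfl := (hC k hk).1 hw
      apply Set.ncard_le_ncard _ (hfin.subset hQ)
      rintro _ ⟨i, hi, rfl⟩
      by_contra hiQ
      have hr := hT.1.preconnected ⟨f 0, hu'.1⟩ ⟨f k, hw'.1⟩
      have := reach_inv (P := fun z => ∃ j < i, f j = z.1) ?_ hr ?_
      · obtain ⟨j, hj, e⟩ := this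
        have := h.inj j (by omega) k le_rfl e
        omega
      · rintro ⟨p, hp⟩ ⟨q, hq⟩ hpq ⟨j, hj, e⟩
        simp only at e
        subst e
        obtain ⟨l, hl, rfl⟩ := hQ hq
        have hpq' : G.Adj (f j) (f l) := by simpa using hpq
        rw [h.adj _ (by omega) _ hl] at hpq'
        have : l ≠ i := by rintro rfl; exact hiQ hq
        exact ⟨l, by omega, rfl⟩
      · refine ⟨0, ?_, rfl⟩
        rcases Nat.eq_zero_or_pos i with rfl | h0
        · exact absurd hu'.1 hiQ
        · exact h0

theorem conn_of_all {α : Type*} {G : SimpleGraph α} [Nonempty α]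
    (h : ∀ x y, x ≠ y → G.Adj x y) : G.Connected := by
  refine ⟨fun x y => ?_⟩
  by_cases e : x = y
  · rw [e]
  · exact (h x y e).reachable

theorem net_of_arms {G : SimpleGraph V} (f : Fin 3 → ℕ → V) (m : Fin 3 → ℕ)
    (hA : ∀ a, Arm G (f a) (m a))
    (hleaf : ∀ a, IsLeaf G (f a 0))
    (hdis : ∀ a b, a ≠ b → ∀ i ≤ m a, ∀ j ≤ m b, f a i ≠ f b j)
    (hadj : ∀ a b, a ≠ b → ∀ i ≤ m a, ∀ j ≤ m b,
      (G.Adj (f a i) (f b j) ↔ i = m a ∧ j = m b)) :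
    ∃ (X : Set V) (H : Net V), IsNet G X H ∧ ∀ E ∈ H.arcs, SimpleArc G H E := by
  have heq : ∀ a b i j, i ≤ m a → j ≤ m b → f a i = f b j → a = b ∧ i = j := by
    intro a b i j hi hj e
    by_cases hab : a = b
    · subst hab
      exact ⟨rfl, (hA a).inj i hi j hj e⟩
    · exact absurd e (hdis a b hab i hi j hj)
  have hex : ∀ a : Fin 3, ∃ b c : Fin 3, a ≠ b ∧ a ≠ c ∧ b ≠ c := by decide
  have hm : ∀ a, 0 < m a := by
    intro a
    by_contra h0
    have h0 : m a = 0 := by omega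
    obtain ⟨b, c, hab, hac, hbc⟩ := hex a
    obtain ⟨w, -, hw⟩ := hleaf a
    have h1 := hw _ ((hadj a b hab 0 (by omega) (m b) le_rfl).2 ⟨h0.symm, rfl⟩)
    have h2 := hw _ ((hadj a c hac 0 (by omega) (m c) le_rfl).2 ⟨h0.symm, rfl⟩)
    exact hdis b c hbc _ le_rfl _ le_rfl (h1.trans h2.symm)
  let L : Set V := {v | ∃ a, f a 0 = v}
  let C : Set V := {v | ∃ a, f a (m a) = v}
  let A : Fin 3 → Set V := fun a => img (f a) (m a)
  have hsub : ∀ a i, i ≤ m a → f a i ∈ A a := fun a i hi => ⟨i, hi, rfl⟩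
  have hAinj : ∀ a b i, i ≤ m a → f a i ∈ A b → a = b := by
    rintro a b i hi ⟨j, hj, e⟩
    exact (heq _ _ _ _ hj hi e).1.symm
  have hAne : ∀ a b, A a = A b → a = b := fun a b e =>
    hAinj a b 0 (by omega) (e ▸ hsub a 0 (by omega))
  have hfst : ∀ a, A a ∩ L = {f a 0} := by
    intro a
    ext v
    constructor
    · rintro ⟨hv, b, rfl⟩
      rw [hAinj b a 0 (by omega) hv]; rfl
    · rintro rfl
      exact ⟨hsub a 0 (by omega), a, rfl⟩
  have hCne : ∀ a, C ≠ {f a 0} := by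
    intro a e
    have : f a (m a) ∈ ({f a 0} : Set V) := e ▸ ⟨a, rfl⟩
    have := (heq _ _ _ _ le_rfl (by omega) this).2
    have := hm a
    omega
  have hsing : ∀ a b, ({f a 0} : Set V) = {f b 0} → a = b := by
    intro a b e
    exact (heq a b 0 0 (by omega) (by omega) (Set.singleton_injective e)).1
  have hCA : ∀ a i, i ≤ m a → (f a i ∈ C ↔ i = m a) := by
    intro a i hi
    constructor
    · rintro ⟨b, e⟩
      obtain ⟨rfl, e'⟩ := heq _ _ _ _ le_rfl hi e
      exact e'.symm
    · rintro rfl; exact ⟨a, rfl⟩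
  let H : Net V :=
    { nodes := {N | N = C ∨ ∃ a, N = {f a 0}}
      arcs := {E | ∃ a, E = A a}
      fst := fun E => E ∩ L
      snd := fun _ => C }
  have hEnds1 : ∀ a b, H.EndsAt (A a) {f b 0} ↔ a = b := by
    intro a b
    constructor
    · rintro (h | h)
      · exact hsing a b ((hfst a).symm.trans h)
      · exact absurd h (hCne b)
    · rintro rfl; exact Or.inl (hfst a)
  have hEnds2 : ∀ a, H.EndsAt (A a) C := fun a => Or.inr rfl
  have hLeaf : ∀ N, H.IsLeafNode N ↔ ∃ a, N = {f a 0} := by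
    intro N
    constructor
    · rintro ⟨rfl | h, E, -, hE⟩
      · have h0 := hE (A 0) ⟨⟨0, rfl⟩, hEnds2 0⟩
        have h1 := hE (A 1) ⟨⟨1, rfl⟩, hEnds2 1⟩
        have := hAne 0 1 (h0.trans h1.symm)
        exact absurd this (by decide)
      · exact h
    · rintro ⟨a, rfl⟩
      refine ⟨Or.inr ⟨a, rfl⟩, A a, ⟨⟨a, rfl⟩, (hEnds1 a a).2 rfl⟩, ?_⟩
      rintro _ ⟨⟨b, rfl⟩, hb⟩
      rw [(hEnds1 b a).1 hb]
  have hCn : C ∈ H.nodes := Or.inl rfl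
  have hAdjN : ∀ a, H.AdjNodes {f a 0} C := fun a =>
    ⟨(hCne a).symm, A a, ⟨a, rfl⟩, Or.inl ⟨hfst a, rfl⟩⟩
  have hgr : ∀ a, H.graph.Adj {f a 0} C := by
    intro a
    rw [Net.graph, SimpleGraph.fromRel_adj]
    exact ⟨(hCne a).symm, Or.inl ⟨Or.inr ⟨a, rfl⟩, hCn, hAdjN a⟩⟩
  have hnab : ∀ M ∈ H.nodes, ∀ N ∈ H.nodes, M ≠ N → H.nabla.Adj M N := by
    intro M hM N hN hne
    rw [Net.nabla, SimpleGraph.fromRel_adj]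
    refine ⟨hne, ?_⟩
    rcases hM with rfl | ⟨a, rfl⟩ <;> rcases hN with rfl | ⟨b, rfl⟩
    · exact absurd rfl hne
    · exact Or.inr (Or.inl ⟨Or.inr ⟨b, rfl⟩, hCn, hAdjN b⟩)
    · exact Or.inl (Or.inl ⟨Or.inr ⟨a, rfl⟩, hCn, hAdjN a⟩)
    · exact Or.inl (Or.inr ⟨(hLeaf _).2 ⟨a, rfl⟩, (hLeaf _).2 ⟨b, rfl⟩⟩)
  have hsimple : ∀ E ∈ H.arcs, SimpleArc G H E := by
    rintro _ ⟨a, rfl⟩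
    exact arm_rung (hA a) (hm a) (hfst a) (hCA a)
  refine ⟨⋃₀ H.arcs, H, ?_, hsimple⟩
  refine
    { nodes_sub := ?_
      fst_mem := ?_
      snd_mem := fun _ _ => hCn
      ends_ne := ?_
      conn := ?_
      bicon := ?_
      arcs_nonempty := ⟨A 0, 0, rfl⟩
      arcs_disjoint := ?_
      arcs_cover := rfl
      leaf_count := ?_
      leaf_single := ?_
      rungs := fun E hE x hx => ⟨E, hx, hsimple E hE⟩
      meets_iff := ?_
      adj_iff := ?_ }
  · rintro N (rfl | ⟨a, rfl⟩)
    · rintro _ ⟨a, rfl⟩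
      exact ⟨A a, ⟨a, rfl⟩, hsub a _ le_rfl⟩
    · rintro _ rfl
      exact ⟨A a, ⟨a, rfl⟩, hsub a _ (by omega)⟩
  · rintro _ ⟨a, rfl⟩
    exact Or.inr ⟨a, hfst a⟩
  · rintro _ ⟨a, rfl⟩ e
    exact hCne a (e.symm.trans (hfst a))
  · have key : ∀ x : H.nodes, (H.graph.induce H.nodes).Reachable ⟨C, hCn⟩ x := by
      rintro ⟨N, rfl | ⟨a, rfl⟩⟩
      · exact SimpleGraph.Reachable.refl _
      · exact SimpleGraph.Adj.reachable (by simpa using (hgr a).symm)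
    have : Nonempty H.nodes := ⟨⟨C, hCn⟩⟩
    exact ⟨fun x y => (key x).symm.trans (key y)⟩
  · have hall : ∀ x y : H.nodes, x ≠ y → (H.nabla.induce H.nodes).Adj x y := by
      rintro ⟨M, hM⟩ ⟨N, hN⟩ hne
      have := hnab M hM N hN (by simpa using hne)
      simpa using this
    have : Nonempty H.nodes := ⟨⟨C, hCn⟩⟩
    refine ⟨conn_of_all hall, fun v => ?_⟩
    have : Nonempty {w : H.nodes | w ≠ v} := by
      by_cases hv : v = ⟨C, hCn⟩
      · refine ⟨⟨⟨{f 0 0}, Or.inr ⟨0, rfl⟩⟩, ?_⟩⟩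
        rw [hv]
        intro e
        exact hCne 0 (Subtype.mk.inj e).symm
      · exact ⟨⟨⟨C, hCn⟩, fun e => hv e.symm⟩⟩
    refine conn_of_all fun x y hne => ?_
    exact hall x.1 y.1 fun e => hne (Subtype.ext e)
  · rintro _ ⟨a, rfl⟩ _ ⟨b, rfl⟩ hne
    rw [Set.eq_empty_iff_forall_notMem]
    rintro _ ⟨⟨i, hi, rfl⟩, h2⟩
    exact hne (by rw [hAinj a b i hi h2])
  · have : {N | H.IsLeafNode N} = (fun a : Fin 3 => ({f a 0} : Set V)) '' Set.univ := by
      ext N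
      rw [Set.mem_ofPred_eq, hLeaf]
      simp [eq_comm]
    rw [this, Set.ncard_image_of_injective _ (fun a b e => hsing a b e)]
    simp [Set.ncard_univ]
  · intro N hN
    obtain ⟨a, rfl⟩ := (hLeaf N).1 hN
    exact ⟨_, hleaf a, rfl⟩
  · rintro _ ⟨a, rfl⟩ N (rfl | ⟨b, rfl⟩)
    · exact ⟨fun _ => hEnds2 a, fun _ => ⟨_, hsub a _ le_rfl, a, rfl⟩⟩
    · rw [hEnds1]
      constructor
      · rintro ⟨_, h1, rfl⟩
        exact (hAinj b a 0 (by omega) h1).symm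
      · rintro rfl
        exact ⟨_, hsub a 0 (by omega), rfl⟩
  · rintro _ ⟨a, rfl⟩ _ ⟨b, rfl⟩ hne _ ⟨i, hi, rfl⟩ _ ⟨j, hj, rfl⟩
    have hab : a ≠ b := fun e => hne (by rw [e])
    rw [hadj a b hab i hi j hj]
    constructor
    · rintro ⟨rfl, rfl⟩
      exact ⟨C, hCn, hEnds2 a, hEnds2 b, ⟨a, rfl⟩, ⟨b, rfl⟩⟩
    · rintro ⟨N, rfl | ⟨c, rfl⟩, -, -, h1, h2⟩
      · exact ⟨(hCA a i hi).1 h1, (hCA b j hj).1 h2⟩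
      · exact absurd (h1.trans h2.symm) (hdis a b hab i hi j hj)

theorem core {G : SimpleGraph V} {f g : ℕ → V} {n e : ℕ} (hf : Arm G f n) (hg : Arm G g e)
    (hl : ∀ v, IsLeaf G v ↔ v = f 0 ∨ v = f n ∨ v = g 0)
    (hd : ∀ i ≤ e, ∀ j ≤ n, g i ≠ f j)
    (hna : ∀ i < e, ∀ j ≤ n, ¬ G.Adj (g i) (f j))
    (hex : ∃ j, j ≤ n ∧ G.Adj (g e) (f j)) :
    (∃ T, IsSapling G T) ∨
      ∃ (X : Set V) (H : Net V), IsNet G X H ∧ ∀ E ∈ H.arcs, SimpleArc G H E := by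
  obtain ⟨a, ⟨han, haA⟩, hamin⟩ : ∃ a, (a ≤ n ∧ G.Adj (g e) (f a)) ∧
      ∀ j ≤ n, G.Adj (g e) (f j) → a ≤ j :=
    ⟨Nat.find hex, Nat.find_spec hex, fun j h1 h2 => Nat.find_min' hex ⟨h1, h2⟩⟩
  obtain ⟨b, ⟨hbn, hbA⟩, hbmax⟩ : ∃ b, (b ≤ n ∧ G.Adj (g e) (f b)) ∧
      ∀ j ≤ n, G.Adj (g e) (f j) → j ≤ b := by
    have hex' : ∃ k, k ≤ n ∧ G.Adj (g e) (f (n - k)) := by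
      obtain ⟨j, h1, h2⟩ := hex
      exact ⟨n - j, by omega, by rwa [Nat.sub_sub_self h1]⟩
    refine ⟨n - Nat.find hex', ⟨by omega, (Nat.find_spec hex').2⟩, fun j h1 h2 => ?_⟩
    have := Nat.find_min' hex' ⟨Nat.sub_le n j, by rwa [Nat.sub_sub_self h1]⟩
    omega
  have hab : a ≤ b := hamin b hbn hbA
  rcases Nat.lt_or_ge (a+1) b with hlt | hge
  · -- two nonadjacent neighbours
    left
    have h1 := attach (T := img g e) hg.tree ((hf.mono han).rev a le_rfl) (w := g e)
      (by
        rintro i hi ⟨j, hj, e'⟩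
        exact hd j hj _ (by omega) e') ⟨e, le_rfl, rfl⟩ haA.symm
      (by
        rintro z ⟨j, hj, rfl⟩ hz
        rcases Nat.lt_or_ge j e with h | h
        · exact absurd hz.symm (hna j h _ (by omega))
        · congr 1; omega)
      (by
        rintro i hi hi0 z ⟨j, hj, rfl⟩ hz
        rcases Nat.lt_or_ge j e with h | h
        · exact absurd hz.symm (hna j h _ (by omega))
        · have : j = e := by omega
          subst this
          have := hamin _ (by omega) hz.symm
          omega)
    have h2 := attach h1 (hf.shift b (n - b) (by omega)) (w := g e)
      (by
        rintro i hi (⟨j, hj, e'⟩ | ⟨j, hj, e'⟩)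
        · exact hd j hj _ (by omega) e'
        · have := hf.inj _ (by omega) _ (by omega) e'
          omega) (Or.inl ⟨e, le_rfl, rfl⟩) hbA.symm
      (by
        rintro z (⟨j, hj, rfl⟩ | ⟨j, hj, rfl⟩) hz
        · rcases Nat.lt_or_ge j e with h | h
          · exact absurd hz.symm (hna j h _ (by omega))
          · congr 1; omega
        · rw [hf.adj _ (by omega) _ (by omega)] at hz
          omega)
      (by
        rintro i hi hi0 z (⟨j, hj, rfl⟩ | ⟨j, hj, rfl⟩) hz
        · rcases Nat.lt_or_ge j e with h | h
          · exact absurd hz.symm (hna j h _ (by omega))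
          · have : j = e := by omega
            subst this
            have := hbmax _ (by omega) hz.symm
            omega
        · rw [hf.adj _ (by omega) _ (by omega)] at hz
          omega)
    refine ⟨_, h2, fun v hv => ?_⟩
    rcases (hl v).1 hv with rfl | rfl | rfl
    · exact Or.inl (Or.inr ⟨a, le_rfl, by simp⟩)
    · refine Or.inr ⟨n - b, le_rfl, ?_⟩
      change f (b + (n - b)) = f n
      congr 1; omega
    · exact Or.inl (Or.inl ⟨0, by omega, rfl⟩)
  rcases Nat.lt_or_ge a b with hlt | hge'
  · right
    have hb : b = a + 1 := by omega
    have hcase : ∀ i ≤ e, ∀ j ≤ n, G.Adj (g i) (f j) → i = e ∧ (j = a ∨ j = b) := by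
      intro i hi j hj h
      have hie : i = e := by
        by_contra hne
        exact hna i (by omega) j hj h
      subst hie
      have := hamin j hj h
      have := hbmax j hj h
      omega
    have gf : ∀ i ≤ e, ∀ j ≤ n, (G.Adj (g i) (f j) ↔ i = e ∧ (j = a ∨ j = b)) := by
      intro i hi j hj
      refine ⟨hcase i hi j hj, ?_⟩
      rintro ⟨rfl, rfl | rfl⟩ <;> assumption
    refine net_of_arms ![f, fun i => f (n - i), g] ![a, n - b, e] ?_ ?_ ?_ ?_
    · intro k
      fin_cases k
      · exact hf.mono han
      · exact hf.rev (n - b) (Nat.sub_le n b)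
      · exact hg
    · intro k
      fin_cases k
      · exact (hl _).2 (Or.inl rfl)
      · exact (hl _).2 (Or.inr (Or.inl rfl))
      · exact (hl _).2 (Or.inr (Or.inr rfl))
    · have h01 : ∀ i ≤ a, ∀ j ≤ n - b, f i ≠ f (n - j) := by
        intro i hi j hj h
        have := hf.inj _ (by omega) _ (by omega) h
        omega
      have h02 : ∀ i ≤ a, ∀ j ≤ e, f i ≠ g j := fun i hi j hj h =>
        hd j hj i (by omega) h.symm
      have h12 : ∀ i ≤ n - b, ∀ j ≤ e, f (n - i) ≠ g j := fun i hi j hj h =>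
        hd j hj _ (by omega) h.symm
      intro k l hkl
      fin_cases k <;> fin_cases l
      · exact absurd rfl hkl
      · exact h01
      · exact h02
      · exact fun i hi j hj h => h01 j hj i hi h.symm
      · exact absurd rfl hkl
      · exact h12
      · exact fun i hi j hj h => h02 j hj i hi h.symm
      · exact fun i hi j hj h => h12 j hj i hi h.symm
      · exact absurd rfl hkl
    · have h01 : ∀ i ≤ a, ∀ j ≤ n - b, (G.Adj (f i) (f (n - j)) ↔ i = a ∧ j = n - b) := by
        intro i hi j hj
        rw [hf.adj _ (by omega) _ (by omega)]
        omega
      have h02 : ∀ i ≤ a, ∀ j ≤ e, (G.Adj (f i) (g j) ↔ i = a ∧ j = e) := by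
        intro i hi j hj
        rw [G.adj_comm, gf j hj i (by omega)]
        omega
      have h12 : ∀ i ≤ n - b, ∀ j ≤ e, (G.Adj (f (n - i)) (g j) ↔ i = n - b ∧ j = e) := by
        intro i hi j hj
        rw [G.adj_comm, gf j hj _ (by omega)]
        omega
      intro k l hkl
      fin_cases k <;> fin_cases l
      · exact absurd rfl hkl
      · exact h01
      · exact h02
      · exact fun i hi j hj => by
          rw [G.adj_comm]; exact (h01 j hj i hi).trans and_comm
      · exact absurd rfl hkl
      · exact h12
      · exact fun i hi j hj => by
          rw [G.adj_comm]; exact (h02 j hj i hi).trans and_comm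
      · exact fun i hi j hj => by
          rw [G.adj_comm]; exact (h12 j hj i hi).trans and_comm
      · exact absurd rfl hkl
  · -- a unique neighbour
    left
    have hba : b = a := by omega
    have h1 := attach (T := img f n) hf.tree (hg.rev e le_rfl) (w := f a)
      (by
        rintro i hi ⟨j, hj, e'⟩
        exact hd _ (by omega) j hj e'.symm) ⟨a, han, rfl⟩ haA
      (by
        rintro z ⟨j, hj, rfl⟩ hz
        have := hamin j hj hz
        have := hbmax j hj hz
        congr 1; omega)
      (by
        rintro i hi hi0 z ⟨j, hj, rfl⟩ hz
        exact hna _ (by omega) j hj hz)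
    refine ⟨_, h1, fun v hv => ?_⟩
    rcases (hl v).1 hv with rfl | rfl | rfl
    · exact Or.inl ⟨0, by omega, rfl⟩
    · exact Or.inl ⟨n, le_rfl, rfl⟩
    · exact Or.inr ⟨e, le_rfl, by simp⟩

/-- `G` contains a sapling, or `G` admits an `X`-net all of
whose arcs are simple. -/
theorem sapling_or_simple_net
    {V : Type*} [Fintype V] (G : SimpleGraph V)
    (hconn : G.Connected) (hleaves : {v | IsLeaf G v}.ncard = 3) :
    (∃ T, IsSapling G T) ∨
      ∃ (X : Set V) (H : Net V), IsNet G X H ∧ ∀ E ∈ H.arcs, SimpleArc G H E := by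
  obtain ⟨x, y, z, hxy, hxz, hyz, hset⟩ := Set.ncard_eq_three.1 hleaves
  have hl : ∀ v, IsLeaf G v ↔ v = x ∨ v = y ∨ v = z := by
    intro v
    have : v ∈ {v | IsLeaf G v} ↔ v ∈ ({x, y, z} : Set V) := by rw [hset]
    simpa using this
  obtain ⟨f, hf0, hfn, hf, -⟩ := arm_of_dist hconn x y
  set n := G.dist x y with hn
  have hzf : ∀ j ≤ n, f j ≠ z := by
    intro j hj e
    obtain ⟨w, -, hw⟩ := (hl z).2 (Or.inr (Or.inr rfl))
    have hj0 : j ≠ 0 := by rintro rfl; exact hxz (hf0.symm.trans e)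
    have hjn : j ≠ n := by rintro rfl; exact hyz (hfn.symm.trans e)
    have h1 := hw (f (j-1)) (by change G.Adj z _; rw [← e, hf.adj _ hj _ (by omega)]; omega)
    have h2 := hw (f (j+1)) (by change G.Adj z _; rw [← e, hf.adj _ hj _ (by omega)]; omega)
    have := hf.inj _ (by omega) _ (by omega) (h1.trans h2.symm)
    omega
  have hex : ∃ d, ∃ j, j ≤ n ∧ G.dist z (f j) = d := ⟨_, 0, by omega, rfl⟩
  obtain ⟨j, hj, hjd⟩ := Nat.find_spec hex
  have hmin : ∀ k ≤ n, Nat.find hex ≤ G.dist z (f k) := fun k hk =>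
    Nat.find_min' hex ⟨k, hk, rfl⟩
  rw [← hjd] at hmin
  obtain ⟨g, hg0, hgn, hg, hgd⟩ := arm_of_dist hconn z (f j)
  have hpos : 0 < G.dist z (f j) := hconn.pos_dist_of_ne (hzf j hj).symm
  obtain ⟨e, he⟩ : ∃ e, G.dist z (f j) = e + 1 := ⟨G.dist z (f j) - 1, by omega⟩
  rw [he] at hmin hgn hg hgd
  refine core (f := f) (g := g) (n := n) (e := e) hf (hg.mono (by omega)) ?_ ?_ ?_ ⟨j, hj, ?_⟩
  · rw [hf0, hfn, hg0]; exact hl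
  · intro i hi k hk h
    have h1 := hgd i (by omega)
    have h2 := hmin k hk
    rw [h] at h1
    omega
  · intro i hi k hk h
    have h1 := hgd i (by omega)
    have h2 := hmin k hk
    have h3 := h.diff_dist_adj (u := z)
    omega
  · rw [← hgn, hg.adj _ (by omega) _ (by omega)]
    omega

end ThreeInATree
end

section
/- If G admits a taming net, that is, there exist X ⊆ V(G) and an X-net ℍ of G such that every Y ⊆ V(G)∖X with G[Y] connected is ℍ-tamed, then G is sapling-free (contains no sapling). -/
attribute [local instance] Classical.propDecidable

namespace ThreeInATree

variable {V : Type*}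

namespace SapAux

open SimpleGraph

variable {α : Type*} {Γ : SimpleGraph α}

lemma mem_of_path (h : Γ.IsAcyclic) {a b x : α} {p : Γ.Walk a b} (hp : p.IsPath)
    (hx : x ∈ p.support) (q : Γ.Walk a b) : x ∈ q.support := by
  classical
  have h1 := (h.subsingleton_path a b).elim ⟨p, hp⟩ ⟨q.bypass, q.bypass_isPath⟩
  have h2 : p = q.bypass := congrArg Subtype.val h1
  rw [h2] at hx
  exact q.support_bypass_subset_support hx

lemma nbr_eq (h : Γ.IsAcyclic) {a b c : α} (ha : Γ.Adj c a) (hb : Γ.Adj c b)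
    (q : Γ.Walk a b) (hq : c ∉ q.support) : a = b := by
  by_contra hne
  refine hq (mem_of_path h (p := Walk.cons ha.symm (Walk.cons hb Walk.nil)) ?_ (by simp) q)
  have := ha.ne
  have := hb.ne
  simp [Walk.isPath_def]
  grind

lemma leaf_interior {a b t : α} {p : Γ.Walk a b} (hp : p.IsPath)
    (hl : ∀ x y, Γ.Adj t x → Γ.Adj t y → x = y) (ha : a ≠ t) (hb : b ≠ t) : t ∉ p.support := by
  intro ht
  obtain ⟨q, r, hq, hr, rfl⟩ := hp.mem_support_iff_exists_append.1 ht
  have hqn : ¬ q.Nil := Walk.not_nil_of_ne ha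
  have hrn : ¬ r.Nil := Walk.not_nil_of_ne hb.symm
  have h1 := q.adj_penultimate hqn
  have h2 := r.adj_snd hrn
  exact Walk.IsPath.ne_of_mem_support_of_append hp h2.ne' (q.getVert_mem_support _)
    (r.getVert_mem_support _) (hl _ _ h1.symm h2)

lemma append_path {a b c : α} {p : Γ.Walk a b} {q : Γ.Walk b c} (hp : p.IsPath) (hq : q.IsPath)
    (h : ∀ x ∈ p.support, x ∈ q.support → x = b) : (p.append q).IsPath := by
  rw [Walk.isPath_def, Walk.support_append, List.nodup_append]
  have hq' := hq.support_nodup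
  rw [← q.cons_tail_support, List.nodup_cons] at hq'
  refine ⟨hp.support_nodup, hq'.2, ?_⟩
  rintro x hx y hy rfl
  have := h x hx (List.mem_of_mem_tail hy)
  subst this
  exact hq'.1 hy

lemma median (h : Γ.IsTree) (t1 t2 t3 : α) : ∃ c,
    (∃ p : Γ.Walk t1 t2, p.IsPath ∧ c ∈ p.support) ∧
    (∃ p : Γ.Walk t1 t3, p.IsPath ∧ c ∈ p.support) ∧
    (∃ p : Γ.Walk t2 t3, p.IsPath ∧ c ∈ p.support) := by
  classical
  obtain ⟨p, hp, -⟩ := h.existsUnique_path t1 t2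
  obtain ⟨c, hc, hmin⟩ := exists_minimalFor_of_wellFoundedLT (· ∈ p.support)
    (fun v => Γ.dist v t3) ⟨t1, p.start_mem_support⟩
  obtain ⟨q, hq, hql⟩ := h.1.exists_path_of_dist c t3
  have key : ∀ x ∈ p.support, x ∈ q.support → x = c := by
    intro x hx hxq
    by_contra hne
    have h1 : (q.takeUntil x hxq).length + (q.dropUntil x hxq).length = q.length := by
      rw [← Walk.length_append, Walk.take_spec]
    have h2 : Γ.dist x t3 ≤ (q.dropUntil x hxq).length := dist_le _
    have h3 : (q.takeUntil x hxq).length ≠ 0 := by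
      intro h0
      exact hne (Walk.eq_of_length_eq_zero h0).symm
    have h4 := hmin hx (by simp only; omega)
    simp only at h4
    omega
  refine ⟨c, ⟨p, hp, hc⟩, ⟨(p.takeUntil c hc).append q, append_path (hp.takeUntil hc) hq ?_, ?_⟩,
    ⟨(p.dropUntil c hc).reverse.append q, append_path (hp.dropUntil hc).reverse hq ?_, ?_⟩⟩
  · exact fun x hx => key x (p.support_takeUntil_subset_support hc hx)
  · simp
  · intro x hx
    rw [Walk.support_reverse, List.mem_reverse] at hx
    exact key x (p.support_dropUntil_subset_support hc hx)
  · simp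

lemma center (h : Γ.IsTree) (t : Fin 3 → α) (ht : Function.Injective t)
    (hl : ∀ i x y, Γ.Adj (t i) x → Γ.Adj (t i) y → x = y) :
    ∃ c, (∀ i, c ≠ t i) ∧ ∀ i j, i ≠ j → ∀ p : Γ.Walk (t i) (t j), c ∈ p.support := by
  obtain ⟨c, ⟨p, hp, h1⟩, ⟨q, hq, h2⟩, ⟨r, hr, h3⟩⟩ := median h (t 0) (t 1) (t 2)
  refine ⟨c, ?_, ?_⟩
  · rintro i rfl
    fin_cases i
    · exact leaf_interior hr (hl 0) (ht.ne (by decide)) (ht.ne (by decide)) h3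
    · exact leaf_interior hq (hl 1) (ht.ne (by decide)) (ht.ne (by decide)) h2
    · exact leaf_interior hp (hl 2) (ht.ne (by decide)) (ht.ne (by decide)) h1
  · have a1 := fun w => mem_of_path h.2 hp h1 w
    have a2 := fun w => mem_of_path h.2 hq h2 w
    have a3 := fun w => mem_of_path h.2 hr h3 w
    intro i j hij w
    fin_cases i <;> fin_cases j
    · exact absurd rfl hij
    · exact a1 w
    · exact a2 w
    · simpa using a1 w.reverse
    · exact absurd rfl hij
    · exact a3 w
    · simpa using a2 w.reverse
    · simpa using a3 w.reverse
    · exact absurd rfl hij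

/-- Abstract core: no tree respects the arc structure. -/
lemma core {ε ν : Type*} (h : Γ.IsTree) (t : Fin 3 → α) (ht : Function.Injective t)
    (hl : ∀ i x y, Γ.Adj (t i) x → Γ.Adj (t i) y → x = y)
    (φ : α → ε) (I : α → ν → Prop) (Ends : ε → ν → Prop)
    (h1 : ∀ u w, Γ.Adj u w → φ u ≠ φ w → ∃ N, I u N ∧ I w N)
    (h2 : ∀ u w N, φ u ≠ φ w → I u N → I w N → Γ.Adj u w)
    (h3 : ∀ v N, I v N → Ends (φ v) N)
    (h4 : ∀ E N1 N2 N3, Ends E N1 → Ends E N2 → Ends E N3 → N1 = N2 ∨ N1 = N3 ∨ N2 = N3)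
    (n : Fin 3 → ν) (hn : ∀ i v, I v (n i) ↔ v = t i) : False := by
  classical
  obtain ⟨c, hct, hsep⟩ := center h t ht hl
  let C : Fin 3 → Set α := fun i => {v | ∃ p : Γ.Walk v (t i), c ∉ p.support}
  have hcC : ∀ i, c ∉ C i := fun i ⟨p, hp⟩ => hp p.start_mem_support
  have htC : ∀ i, t i ∈ C i := fun i => ⟨Walk.nil, by simpa using hct i⟩
  have hdisj : ∀ i j, i ≠ j → ∀ v, v ∈ C i → v ∉ C j := by
    rintro i j hij v ⟨p, hp⟩ ⟨q, hq⟩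
    have := hsep i j hij (p.reverse.append q)
    simp [Walk.mem_support_append_iff] at this
    tauto
  have hnoadj : ∀ i j, i ≠ j → ∀ u v, u ∈ C i → v ∈ C j → ¬ Γ.Adj u v := by
    rintro i j hij u v ⟨p, hp⟩ ⟨q, hq⟩ hadj
    have := hsep i j hij (p.reverse.append (Walk.cons hadj q))
    simp [Walk.mem_support_append_iff] at this
    have hcu : c ≠ u := fun e => hp (e ▸ p.start_mem_support)
    tauto
  have hnbr : ∀ i u v, u ∈ C i → v ∈ C i → Γ.Adj c u → Γ.Adj c v → u = v := by
    rintro i u v ⟨p, hp⟩ ⟨q, hq⟩ hu hv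
    refine nbr_eq h.2 hu hv (p.append q.reverse) ?_
    simp [Walk.mem_support_append_iff]
    tauto
  -- crossing edges inside a branch
  have hcross : ∀ i (S : Set α) w, w ∈ C i → w ∈ S → t i ∉ S →
      ∃ u x, u ∈ C i ∧ x ∈ C i ∧ u ∈ S ∧ x ∉ S ∧ Γ.Adj u x := by
    rintro i S w ⟨p, hp⟩ hw hS
    obtain ⟨d, hd, hd1, hd2⟩ := p.exists_boundary_dart S hw hS
    have e1 := p.dart_fst_mem_support_of_mem_darts hd
    have e2 := p.dart_snd_mem_support_of_mem_darts hd
    exact ⟨d.fst, d.snd, ⟨p.dropUntil _ e1, fun hh => hp (p.support_dropUntil_subset_support e1 hh)⟩,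
      ⟨p.dropUntil _ e2, fun hh => hp (p.support_dropUntil_subset_support e2 hh)⟩, hd1, hd2, d.adj⟩
  have hstart : ∀ i, ∃ w ∈ C i, Γ.Adj c w := by
    intro i
    obtain ⟨p, hp, -⟩ := h.existsUnique_path c (t i)
    have hnn : ¬ p.Nil := Walk.not_nil_of_ne (hct i)
    refine ⟨p.snd, ⟨p.tail, ?_⟩, p.adj_snd hnn⟩
    have := hp.support_nodup
    rw [← p.cons_tail_support, List.nodup_cons] at this
    rw [p.support_tail_of_not_nil hnn]
    exact this.1
  -- stage: leave the arc of `w`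
  have hexit : ∀ i w, w ∈ C i → ∃ u ∈ C i, φ u = φ w ∧ ∃ N, I u N ∧
      (u = t i ∧ N = n i ∨ ∃ x ∈ C i, φ x ≠ φ w ∧ I x N ∧ Γ.Adj u x) := by
    intro i w hw
    by_cases hE : φ (t i) = φ w
    · exact ⟨t i, htC i, hE, n i, (hn _ _).2 rfl, Or.inl ⟨rfl, rfl⟩⟩
    · obtain ⟨u, x, hu, hx, hu', hx', hadj⟩ := hcross i {v | φ v = φ w} w hw rfl hE
      have hu'' : φ u = φ w := hu'
      have hx'' : φ x ≠ φ w := hx'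
      obtain ⟨N, ha, hb⟩ := h1 u x hadj (by rw [hu'']; exact hx''.symm)
      exact ⟨u, hu, hu'', N, ha, Or.inr ⟨x, hx, hx'', hb, hadj⟩⟩
  have hfirst : ∀ i, ∃ u, (u = c ∨ u ∈ C i) ∧ φ u = φ c ∧ ∃ N, I u N ∧
      (u = t i ∧ N = n i ∨ ∃ x ∈ C i, φ x ≠ φ c ∧ I x N ∧ Γ.Adj u x) := by
    intro i
    obtain ⟨w, hw, hadj⟩ := hstart i
    by_cases hE : φ w = φ c
    · obtain ⟨u, hu, r⟩ := hexit i w hw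
      rw [hE] at r
      exact ⟨u, Or.inr hu, r⟩
    · obtain ⟨N, ha, hb⟩ := h1 c w hadj (Ne.symm hE)
      exact ⟨c, Or.inl rfl, rfl, N, ha, Or.inr ⟨w, hw, hE, hb, hadj⟩⟩
  choose u hu hφu N hIu hu2 using hfirst
  -- two branches leaving the same arc `F` through the same node is impossible
  have hpair : ∀ i j, i ≠ j → N i = N j → False := by
    intro i j hij hN
    rcases hu2 i with ⟨ei, eNi⟩ | ⟨x, hx, hφx, hIx, hax⟩
    · have := hIu j
      rw [← hN, eNi, hn] at this
      rcases hu j with e | e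
      · exact hct i (e.symm.trans this)
      · exact hdisj i j hij _ (htC i) (this ▸ e)
    rcases hu2 j with ⟨ej, eNj⟩ | ⟨y, hy, hφy, hIy, hay⟩
    · have := hIu i
      rw [hN, eNj, hn] at this
      rcases hu i with e | e
      · exact hct j (e.symm.trans this)
      · exact hdisj j i hij.symm _ (htC j) (this ▸ e)
    have c1 : Γ.Adj (u i) y := h2 _ _ (N i) (by rw [hφu]; exact hφy.symm) (hIu i) (hN ▸ hIy)
    have c2 : Γ.Adj (u j) x := h2 _ _ (N i) (by rw [hφu]; exact hφx.symm) (hN ▸ hIu j) hIx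
    rcases hu i with ei | ei
    swap
    · exact hnoadj i j hij _ _ ei hy c1
    rcases hu j with ej | ej
    swap
    · exact hnoadj j i hij.symm _ _ ej hx c2
    rw [ei] at hax c1
    rw [ej] at hay c2
    have hIc : I c (N i) := ei ▸ hIu i
    rw [← hN] at hIy
    have hF : φ x = φ y := by
      by_contra hne
      exact hnoadj i j hij _ _ hx hy (h2 _ _ _ hne hIx hIy)
    -- second stage
    have hsec : ∀ k l x y, k ≠ l → x ∈ C k → y ∈ C l → φ x = φ y → φ x ≠ φ c →
        I x (N i) → I y (N i) → ∃ v ∈ C k, φ v = φ x ∧ ∃ M, M ≠ N i ∧ I v M ∧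
        (v = t k ∧ M = n k ∨ ∃ z ∈ C k, φ z ≠ φ x ∧ I z M ∧ Γ.Adj v z) := by
      intro k l x y hkl hx hy hxy hxc hIx hIy
      obtain ⟨v, hv, hφv, M, hIv, hr⟩ := hexit k x hx
      refine ⟨v, hv, hφv, M, ?_, hIv, hr⟩
      rintro rfl
      rcases hr with ⟨e1, e2⟩ | ⟨z, hz, hφz, hIz, haz⟩
      · rw [e2, hn] at hIc
        exact hct k hIc
      · exact hnoadj k l hkl _ _ hz hy (h2 _ _ _ (by rw [← hxy]; exact hφz) hIz hIy)
    obtain ⟨v, hv, hφv, M, hM, hIv, hr⟩ := hsec i j x y hij hx hy hF hφx hIx hIy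
    obtain ⟨v', hv', hφv', M', hM', hIv', hr'⟩ :=
      hsec j i y x hij.symm hy hx hF.symm hφy hIy hIx
    have hMM : M = M' := by
      rcases h4 (φ x) M M' (N i) (hφv ▸ h3 _ _ hIv) (by rw [hF]; exact hφv' ▸ h3 _ _ hIv')
        (h3 _ _ hIx) with e | e | e
      · exact e
      · exact absurd e hM
      · exact absurd e hM'
    subst hMM
    rcases hr with ⟨e1, e2⟩ | ⟨z, hz, hφz, hIz, haz⟩
    · rw [e2, hn] at hIv'
      exact hdisj i j hij _ (htC i) (hIv' ▸ hv')
    rcases hr' with ⟨e1, e2⟩ | ⟨z', hz', hφz', hIz', haz'⟩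
    · rw [e2, hn] at hIv
      exact hdisj j i hij.symm _ (htC j) (hIv ▸ hv)
    exact hnoadj i j hij _ _ hv hz' (h2 _ _ M (by rw [hφv, hF]; exact hφz'.symm) hIv hIz')
  have hE : ∀ i, Ends (φ c) (N i) := fun i => hφu i ▸ h3 _ _ (hIu i)
  rcases h4 _ _ _ _ (hE 0) (hE 1) (hE 2) with e | e | e
  · exact hpair 0 1 (by decide) e
  · exact hpair 0 2 (by decide) e
  · exact hpair 1 2 (by decide) e

end SapAux

/-- If `G` admits a taming net, then `G` is sapling-free. -/
theorem taming_net_implies_sapling_free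
    {V : Type*} [Fintype V] (G : SimpleGraph V)
    (hconn : G.Connected) (hleaves : {v | IsLeaf G v}.ncard = 3)
    (X : Set V) (H : Net V) (hnet : IsNet G X H) (htaming : Taming G X H) :
    SaplingFree G := by
  rintro ⟨T, hT, hTl⟩
  -- the leaf nodes
  have hleafnode : ∀ v, IsLeaf G v → H.IsLeafNode {v} := by
    have hsub : {N | H.IsLeafNode N} ⊆ (fun v => ({v} : Set V)) '' {v | IsLeaf G v} := by
      intro N hN
      obtain ⟨v, hv, rfl⟩ := hnet.leaf_single N hN
      exact ⟨v, hv, rfl⟩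
    have hfin : ((fun v => ({v} : Set V)) '' {v | IsLeaf G v}).Finite := Set.toFinite _
    have heq := Set.eq_of_subset_of_ncard_le hsub (by
      rw [hnet.leaf_count, ← hleaves]
      exact Set.ncard_image_le (Set.toFinite _)) hfin
    intro v hv
    have : ({v} : Set V) ∈ {N | H.IsLeafNode N} := by
      rw [heq]
      exact ⟨v, hv, rfl⟩
    exact this
  obtain ⟨a, b, c, hab, hac, hbc, habc⟩ := Set.ncard_eq_three.1 hleaves
  have hla : IsLeaf G a := by
    have : a ∈ {v | IsLeaf G v} := by rw [habc]; simp
    exact this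
  have hlb : IsLeaf G b := by
    have : b ∈ {v | IsLeaf G v} := by rw [habc]; simp
    exact this
  have hlc : IsLeaf G c := by
    have : c ∈ {v | IsLeaf G v} := by rw [habc]; simp
    exact this
  let t : Fin 3 → T := ![⟨a, hTl a hla⟩, ⟨b, hTl b hlb⟩, ⟨c, hTl c hlc⟩]
  have htl : ∀ i, IsLeaf G (t i) := by
    intro i
    fin_cases i
    · exact hla
    · exact hlb
    · exact hlc
  have htinj : Function.Injective t := by
    intro i j hij
    fin_cases i <;> fin_cases j <;> simp_all [t] <;> grind
  have htX : ∀ i, (t i : V) ∈ X := fun i =>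
    hnet.nodes_sub _ (hleafnode _ (htl i)).1 rfl
  have harc : ∀ x ∈ X, ∃ E ∈ H.arcs, x ∈ E := by
    intro x hx
    rw [← hnet.arcs_cover] at hx
    exact hx
  have harcX : ∀ E ∈ H.arcs, ∀ x ∈ E, x ∈ X := by
    intro E hE x hx
    rw [← hnet.arcs_cover]
    exact ⟨E, hE, hx⟩
  have harcu : ∀ E ∈ H.arcs, ∀ F ∈ H.arcs, ∀ x, x ∈ E → x ∈ F → E = F := by
    intro E hE F hF x hxE hxF
    by_contra hne
    have := hnet.arcs_disjoint E hE F hF hne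
    exact Set.notMem_empty x (this ▸ ⟨hxE, hxF⟩)
  -- reach relation outside `X`
  let Γ := G.induce T
  let R : T → T → Prop := fun v y => ∃ p : Γ.Walk v y, ∀ z ∈ p.support, (z : V) ∉ X
  let A : T → Set V → Prop := fun v E => ∃ y x : T, R v y ∧ Γ.Adj y x ∧ (x : V) ∈ E
  have hAex : ∀ v : T, (v : V) ∉ X → ∃ E ∈ H.arcs, A v E := by
    intro v hv
    obtain ⟨p⟩ := hT.1.preconnected v (t 0)
    have hvv : R v v := ⟨SimpleGraph.Walk.nil, by simpa using hv⟩
    obtain ⟨d, hd, hd1, hd2⟩ := p.exists_boundary_dart {y | R v y} hvv (by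
      rintro ⟨q, hq⟩
      exact hq _ q.end_mem_support (htX 0))
    obtain ⟨q, hq⟩ : R v d.fst := hd1
    have hx : (d.snd : V) ∈ X := by
      by_contra hx
      refine hd2 ⟨q.concat d.adj, ?_⟩
      intro z hz
      rw [SimpleGraph.Walk.support_concat] at hz
      simp only [List.concat_eq_append, List.mem_append, List.mem_singleton] at hz
      rcases hz with hz | rfl
      · exact hq z hz
      · exact hx
    obtain ⟨E, hE, hxE⟩ := harc _ hx
    exact ⟨E, hE, d.fst, d.snd, ⟨q, hq⟩, d.adj, hxE⟩
  have hAun : ∀ v : T, (v : V) ∉ X → ∀ E ∈ H.arcs, ∀ F ∈ H.arcs, A v E → A v F → E = F := by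
    rintro v hv E hE F hF ⟨y, x, ⟨p, hp⟩, hyx, hxE⟩ ⟨y', x', ⟨p', hp'⟩, hyx', hxF⟩
    by_contra hne
    -- the connected set
    let q : Γ.Walk y y' := p.reverse.append p'
    have hq : ∀ z ∈ q.support, (z : V) ∉ X := by
      intro z hz
      rw [SimpleGraph.Walk.mem_support_append_iff, SimpleGraph.Walk.support_reverse,
        List.mem_reverse] at hz
      exact hz.elim (hp z) (hp' z)
    let q' : G.Walk (y : V) (y' : V) := q.map (SimpleGraph.Embedding.induce T).toHom
    have hq' : ∀ z ∈ q'.support, z ∉ X := by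
      intro z hz
      have hz : z ∈ (q.map (SimpleGraph.Embedding.induce T).toHom).support := hz
      erw [SimpleGraph.Walk.support_map, List.mem_map] at hz
      obtain ⟨z', hz', rfl⟩ := hz
      exact hq z' hz'
    have htame := htaming {z | z ∈ q'.support} (fun z hz => hq' z hz)
      q'.connected_induce_support
    have hxX := harcX E hE _ hxE
    have hxX' := harcX F hF _ hxF
    rcases htame x ⟨hxX, y, q'.start_mem_support, hyx⟩ x' ⟨hxX', y', q'.end_mem_support, hyx'⟩ with
      ⟨D, hD, h1, h2⟩ | ⟨N, hN, h1, h2⟩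
    · exact hne ((harcu E hE D hD _ hxE h1).trans (harcu D hD F hF _ h2 hxF))
    · have hadj : G.Adj (x : V) x' := (hnet.adj_iff E hE F hF hne _ hxE _ hxF).2
        ⟨N, hN, (hnet.meets_iff E hE N hN).1 ⟨_, hxE, h1⟩,
          (hnet.meets_iff F hF N hN).1 ⟨_, hxF, h2⟩, h1, h2⟩
      have hadj' : Γ.Adj x x' := hadj
      have hxx : x ≠ x' := hadj'.ne
      have := SapAux.nbr_eq hT.2 (c := x) (a := y) (b := x') hyx.symm hadj' (q.concat hyx') (by
        rw [SimpleGraph.Walk.support_concat]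
        simp only [List.concat_eq_append, List.mem_append, List.mem_singleton, not_or]
        exact ⟨fun hh => hq x hh hxX, hxx⟩)
      exact hq y q.start_mem_support (this ▸ hxX')
  -- the arc of a vertex of the tree
  have hφ : ∀ v : T, ∃ E ∈ H.arcs, ((v : V) ∈ X → (v : V) ∈ E) ∧ ((v : V) ∉ X → A v E) := by
    intro v
    by_cases hv : (v : V) ∈ X
    · obtain ⟨E, hE, h⟩ := harc _ hv
      exact ⟨E, hE, fun _ => h, fun h' => absurd hv h'⟩
    · obtain ⟨E, hE, h⟩ := hAex v hv
      exact ⟨E, hE, fun h' => absurd h' hv, fun _ => h⟩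
  choose φ hφa hφX hφA using hφ
  have hcr1 : ∀ u w : T, Γ.Adj u w → φ u ≠ φ w → (w : V) ∈ X → (u : V) ∈ X := by
    intro u w hadj hne hw
    by_contra hu
    refine hne (hAun u hu _ (hφa u) _ (hφa w) (hφA u hu) ⟨u, w, ⟨SimpleGraph.Walk.nil, ?_⟩, hadj, hφX w hw⟩)
    simpa using hu
  have hcr : ∀ u w : T, Γ.Adj u w → φ u ≠ φ w → (u : V) ∈ X := by
    intro u w hadj hne
    by_cases hw : (w : V) ∈ X
    · exact hcr1 u w hadj hne hw
    · by_contra hu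
      obtain ⟨y, x, ⟨p, hp⟩, hyx, hx⟩ := hφA w hw
      refine hne (hAun u hu _ (hφa u) _ (hφa w) (hφA u hu)
        ⟨y, x, ⟨SimpleGraph.Walk.cons hadj p, ?_⟩, hyx, hx⟩)
      intro z hz
      rw [SimpleGraph.Walk.support_cons, List.mem_cons] at hz
      rcases hz with rfl | hz
      · exact hu
      · exact hp z hz
  refine SapAux.core hT t htinj ?_ φ (fun v N => N ∈ H.nodes ∧ (v : V) ∈ N) H.EndsAt
    ?_ ?_ ?_ ?_ (fun i => {(t i : V)}) ?_
  · intro i x y hx hy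
    have hx' : G.Adj (t i : V) x := hx
    have hy' : G.Adj (t i : V) y := hy
    exact Subtype.ext ((htl i).unique hx' hy')
  · intro u w hadj hne
    have hu := hφX u (hcr u w hadj hne)
    have hw := hφX w (hcr w u hadj.symm hne.symm)
    obtain ⟨N, hN, -, -, h1, h2⟩ :=
      (hnet.adj_iff _ (hφa u) _ (hφa w) hne _ hu _ hw).1 hadj
    exact ⟨N, ⟨hN, h1⟩, hN, h2⟩
  · rintro u w N hne ⟨hN, hu⟩ ⟨-, hw⟩
    have hu' := hφX u (hnet.nodes_sub N hN hu)
    have hw' := hφX w (hnet.nodes_sub N hN hw)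
    exact (hnet.adj_iff _ (hφa u) _ (hφa w) hne _ hu' _ hw').2
      ⟨N, hN, (hnet.meets_iff _ (hφa u) N hN).1 ⟨_, hu', hu⟩,
        (hnet.meets_iff _ (hφa w) N hN).1 ⟨_, hw', hw⟩, hu, hw⟩
  · rintro v N ⟨hN, hv⟩
    exact (hnet.meets_iff _ (hφa v) N hN).1 ⟨_, hφX v (hnet.nodes_sub N hN hv), hv⟩
  · rintro E N1 N2 N3 (h | h) (h' | h') (h'' | h'') <;> grind
  · intro i v
    constructor
    · rintro ⟨-, h⟩
      exact Subtype.ext h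
    · rintro rfl
      exact ⟨(hleafnode _ (htl i)).1, rfl⟩

end ThreeInATree
end

section
/- If an X-net ℍ of G has no parallel arcs (no two arcs have the same pair of end-nodes), then every ℍ-tamed subset of X is ℍ-local. -/
attribute [local instance] Classical.propDecidable

namespace ThreeInATree

variable {V : Type*}

theorem aux_prop {a b c p q r : Prop} (a1 : ¬ p → a ∨ b) (a2 : ¬ q → a ∨ c) (a3 : ¬ r → b ∨ c)
    (c1 : p → ¬ c) (c2 : q → ¬ b) (c3 : r → ¬ a) (d12 : p → ¬ q) (d13 : p → ¬ r)
    (d23 : q → ¬ r) : ((a ∧ b) ∨ (b ∧ c)) ∨ (c ∧ a) := by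
  by_cases p <;> by_cases q <;> by_cases r <;> by_cases a <;> by_cases b <;> by_cases c <;> simp_all

theorem aux_endsAt {V : Type*} {G : SimpleGraph V} {X : Set V} {H : Net V} (hnet : IsNet G X H)
    {x : V} {E N : Set V} (hE : E ∈ H.arcs) (hN : N ∈ H.nodes) (hx : x ∈ E) (hxN : x ∈ N) :
    H.EndsAt E N := (hnet.meets_iff E hE N hN).1 ⟨x, hx, hxN⟩

theorem aux_three {V : Type*} {H : Net V} {E A B C : Set V}
    (hA : H.EndsAt E A) (hB : H.EndsAt E B) (hC : H.EndsAt E C) (hAB : A ≠ B) :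
    C = A ∨ C = B := by
  unfold Net.EndsAt at *
  grind

theorem aux_adj {V : Type*} {H : Net V} {E A B : Set V} (hE : E ∈ H.arcs)
    (hA : H.EndsAt E A) (hB : H.EndsAt E B) (hAB : A ≠ B) : H.AdjNodes A B := by
  refine ⟨hAB, E, hE, ?_⟩
  unfold Net.EndsAt at *
  grind

theorem aux_unique {V : Type*} {H : Net V} (hpar : NoParallel H) {E F A B : Set V}
    (hE : E ∈ H.arcs) (hF : F ∈ H.arcs) (hEF : E ≠ F)
    (hA : H.EndsAt E A) (hB : H.EndsAt E B) (hA' : H.EndsAt F A) (hB' : H.EndsAt F B) :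
    A = B := by
  by_contra hAB
  apply hpar E hE F hF hEF
  unfold Net.EndsAt at *
  ext Z
  simp only [Set.mem_insert_iff, Set.mem_singleton_iff]
  grind

theorem aux_tamed {V : Type*} {G : SimpleGraph V} {X : Set V} {H : Net V} (hnet : IsNet G X H)
    {S : Set V} (hS : Tamed H S) {u v : V} {E F : Set V} (hu : u ∈ S) (hv : v ∈ S)
    (hE : E ∈ H.arcs) (hF : F ∈ H.arcs) (huE : u ∈ E) (hvF : v ∈ F) (hEF : E ≠ F) :
    ∃ N ∈ H.nodes, u ∈ N ∧ v ∈ N ∧ H.EndsAt E N ∧ H.EndsAt F N := by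
  have key : ∀ A ∈ H.arcs, ∀ B ∈ H.arcs, ∀ x, x ∈ A → x ∈ B → A = B := by
    intro A hA B hB x hxA hxB
    by_contra hne
    have h : x ∈ A ∩ B := ⟨hxA, hxB⟩
    rw [hnet.arcs_disjoint A hA B hB hne] at h
    exact h
  rcases hS u hu v hv with ⟨A, hA, h1, h2⟩ | ⟨N, hN, h1, h2⟩
  · exact absurd ((key E hE A hA u huE h1).trans (key A hA F hF v h2 hvF)) hEF
  · exact ⟨N, hN, h1, h2, aux_endsAt hnet hE hN huE h1, aux_endsAt hnet hF hN hvF h2⟩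

/-- If an `X`-net `ℍ` has no parallel arcs, then every
`ℍ`-tamed subset of `X` is `ℍ`-local. -/
theorem tamed_implies_local_of_no_parallel
    {V : Type*} [Fintype V] (G : SimpleGraph V)
    (hconn : G.Connected) (hleaves : {v | IsLeaf G v}.ncard = 3)
    (X : Set V) (H : Net V) (hnet : IsNet G X H) (hpar : NoParallel H) :
    ∀ S : Set V, S ⊆ X → Tamed H S → LocalSet H S := by
  intro S hSX hS
  have harc : ∀ x ∈ S, ∃ E ∈ H.arcs, x ∈ E := by
    intro x hx
    have h := hSX hx
    rw [← hnet.arcs_cover] at h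
    exact h
  by_cases hone : ∃ E ∈ H.arcs, S ⊆ E
  · exact Or.inr (Or.inl hone)
  by_cases hnode : ∃ N ∈ H.nodes, S ⊆ N
  · exact Or.inl hnode
  refine Or.inr (Or.inr ?_)
  push Not at hone hnode
  obtain ⟨u, hu⟩ : S.Nonempty := by
    obtain ⟨E, hE⟩ := hnet.arcs_nonempty
    obtain ⟨x, hx, _⟩ := Set.not_subset.1 (hone E hE)
    exact ⟨x, hx⟩
  obtain ⟨E, hE, huE⟩ := harc u hu
  obtain ⟨v, hv, hvE⟩ := Set.not_subset.1 (hone E hE)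
  obtain ⟨F, hF, hvF⟩ := harc v hv
  have hEF : E ≠ F := by rintro rfl; exact hvE hvF
  obtain ⟨N, hN, huN, hvN, hEN, hFN⟩ := aux_tamed hnet hS hu hv hE hF huE hvF hEF
  obtain ⟨w, hw, hwN⟩ := Set.not_subset.1 (hnode N hN)
  obtain ⟨D, hD, hwD⟩ := harc w hw
  have hDE : E ≠ D := by
    rintro rfl
    obtain ⟨M, hM, hwM, hvM, h1, h2⟩ := aux_tamed hnet hS hw hv hE hF hwD hvF hEF
    exact hwN (aux_unique hpar hE hF hEF h1 hEN h2 hFN ▸ hwM)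
  have hDF : F ≠ D := by
    rintro rfl
    obtain ⟨M, hM, huM, hwM, h1, h2⟩ := aux_tamed hnet hS hu hw hE hF huE hwD hEF
    exact hwN (aux_unique hpar hE hF hEF h1 hEN h2 hFN ▸ hwM)
  obtain ⟨N1, hN1, huN1, hwN1, hEN1, hDN1⟩ := aux_tamed hnet hS hu hw hE hD huE hwD hDE
  obtain ⟨N2, hN2, hvN2, hwN2, hFN2, hDN2⟩ := aux_tamed hnet hS hv hw hF hD hvF hwD hDF
  have n1 : N ≠ N1 := by rintro rfl; exact hwN hwN1
  have n2 : N ≠ N2 := by rintro rfl; exact hwN hwN2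
  have n12 : N1 ≠ N2 := by
    rintro rfl
    exact n1 (aux_unique hpar hE hF hEF hEN hEN1 hFN hFN2)
  refine ⟨_, ⟨N, N1, N2, hN, hN1, hN2, aux_adj hE hEN hEN1 n1, aux_adj hD hDN1 hDN2 n12,
    aux_adj hF hFN hFN2 n2, rfl⟩, ?_⟩
  intro x hx
  obtain ⟨K, hK, hxK⟩ := harc x hx
  have a1 : K ≠ E → x ∈ N ∨ x ∈ N1 := by
    intro h
    obtain ⟨M, _, hxM, _, _, h2⟩ := aux_tamed hnet hS hx hu hK hE hxK huE h
    rcases aux_three hEN hEN1 h2 n1 with rfl | rfl <;> simp [hxM]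
  have a2 : K ≠ F → x ∈ N ∨ x ∈ N2 := by
    intro h
    obtain ⟨M, _, hxM, _, _, h2⟩ := aux_tamed hnet hS hx hv hK hF hxK hvF h
    rcases aux_three hFN hFN2 h2 n2 with rfl | rfl <;> simp [hxM]
  have a3 : K ≠ D → x ∈ N1 ∨ x ∈ N2 := by
    intro h
    obtain ⟨M, _, hxM, _, _, h2⟩ := aux_tamed hnet hS hx hw hK hD hxK hwD h
    rcases aux_three hDN1 hDN2 h2 n12 with rfl | rfl <;> simp [hxM]
  have b : ∀ A ∈ H.nodes, x ∈ A → H.EndsAt K A := fun A hA h => aux_endsAt hnet hK hA hxK h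
  have c1 : K = E → x ∉ N2 := by
    rintro rfl h
    rcases aux_three hEN hEN1 (b N2 hN2 h) n1 with h | h
    · exact n2 h.symm
    · exact n12 h.symm
  have c2 : K = F → x ∉ N1 := by
    rintro rfl h
    rcases aux_three hFN hFN2 (b N1 hN1 h) n2 with h | h
    · exact n1 h.symm
    · exact n12 h
  have c3 : K = D → x ∉ N := by
    rintro rfl h
    rcases aux_three hDN1 hDN2 (b N hN h) n12 with h | h
    · exact n1 h
    · exact n2 h
  simp only [Set.mem_union, Set.mem_inter_iff]
  have d12 : K = E → K ≠ F := fun h => h ▸ hEF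
  have d13 : K = E → K ≠ D := fun h => h ▸ hDE
  have d23 : K = F → K ≠ D := fun h => h ▸ hDF
  exact aux_prop a1 a2 a3 c1 c2 c3 d12 d13 d23

end ThreeInATree
end
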